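/- Convergence of symmetrized truncated Lévy–Khintchine exponents: Let A be a symmetric positive semidefinite d×d real matrix and let φ : ℝ^d → [0,∞) be measurable with ∫_{ℝ^d} |y|²/(1+|y|²) φ(y) dy < ∞. Let (ε_n) be a sequence of positive reals converging to 0, set A_n = A + ε_n I_d and φ_n(y) = φ(y)·1_{|y| > 1/n}, and let φ_n* and φ* be the symmetric decreasing rearrangements of φ_n and φ. Define Ψ_n*(ξ) = (1/2)(det A_n)^{1/d} |ξ|² + ∫_{ℝ^d} [1 − cos(⟨ξ,y⟩)] φ_n*(y) dy and Ψ*(ξ) = (1/2)(det A)^{1/d} |ξ|² + ∫_{ℝ^d} [1 − cos(⟨ξ,y⟩)] φ*(y) dy. Then for every ξ ∈ ℝ^d, the integrals defining Ψ_n*(ξ) and Ψ*(ξ) are finite and lim_{n→∞} Ψ_n*(ξ) = Ψ*(ξ). -/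

import Mathlib

open MeasureTheory ENNReal Filter Topology
open scoped RealInnerProductSpace

/-- A nonnegative function on `ℝ^d` vanishes at infinity if all its positive
super-level sets have finite Lebesgue measure. -/
def VanishesAtInfinity {d : ℕ} (f : EuclideanSpace ℝ (Fin d) → ℝ) : Prop :=
  ∀ t : ℝ, 0 < t → volume {x : EuclideanSpace ℝ (Fin d) | t < f x} < ⊤

/-- Radius of the ball centered at the origin having the same volume as `A`. -/
noncomputable def symmRadius {d : ℕ} (A : Set (EuclideanSpace ℝ (Fin d))) : ℝ :=
  ((volume A / volume (Metric.ball (0 : EuclideanSpace ℝ (Fin d)) 1)).toReal) ^ ((1 : ℝ) / d)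

/-- `A*`: the open ball centered at the origin with the same Lebesgue measure as `A`. -/
noncomputable def ballStar {d : ℕ} (A : Set (EuclideanSpace ℝ (Fin d))) :
    Set (EuclideanSpace ℝ (Fin d)) :=
  Metric.ball 0 (symmRadius A)

/-- Symmetric decreasing rearrangement `f*` (with values in `[0,∞]`):
`f*(x) = ∫₀^∞ 1_{{f>t}*}(x) dt`. -/
noncomputable def symmRearrange {d : ℕ} (f : EuclideanSpace ℝ (Fin d) → ℝ)
    (x : EuclideanSpace ℝ (Fin d)) : ℝ≥0∞ :=
  ∫⁻ t in Set.Ioi (0 : ℝ), (ballStar {y | t < f y}).indicator (fun _ => (1 : ℝ≥0∞)) x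


/-- The truncated Lévy density `φ_n(y) = φ(y)·1_{|y| > 1/n}`. -/
noncomputable def phiTrunc {d : ℕ} (φ : EuclideanSpace ℝ (Fin d) → ℝ) (n : ℕ)
    (y : EuclideanSpace ℝ (Fin d)) : ℝ :=
  if 1 / (n : ℝ) < ‖y‖ then φ y else 0

/-- The integral part `∫ (1 - cos⟨ξ,y⟩) ψ*(y) dy` of the symmetrized exponent, in `[0,∞]`. -/
noncomputable def symmExponentIntegral {d : ℕ} (ψ : EuclideanSpace ℝ (Fin d) → ℝ)
    (ξ : EuclideanSpace ℝ (Fin d)) : ℝ≥0∞ :=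
  ∫⁻ y, ENNReal.ofReal (1 - Real.cos ⟪ξ, y⟫) * symmRearrange ψ y

/-- The symmetrized Lévy–Khintchine exponent
`Ψ*(ξ) = (1/2)(det M)^{1/d}|ξ|² + ∫ (1 - cos⟨ξ,y⟩) ψ*(y) dy`, in `[0,∞]`. -/
noncomputable def symmExponent {d : ℕ} (M : Matrix (Fin d) (Fin d) ℝ)
    (ψ : EuclideanSpace ℝ (Fin d) → ℝ) (ξ : EuclideanSpace ℝ (Fin d)) : ℝ≥0∞ :=
  ENNReal.ofReal ((1 / 2) * M.det ^ ((1 : ℝ) / d) * ‖ξ‖ ^ 2) + symmExponentIntegral ψ ξ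

section SymmetricRearrangement

variable {d : ℕ}

lemma lintegral_mul_lintegral_indicator_slice {S : Set (ℝ × EuclideanSpace ℝ (Fin d))}
    (hS : MeasurableSet S) {W : EuclideanSpace ℝ (Fin d) → ℝ≥0∞} (hW : Measurable W) :
    ∫⁻ y, W y * ∫⁻ t in Set.Ioi (0 : ℝ), {z | (t, z) ∈ S}.indicator (fun _ => (1 : ℝ≥0∞)) y =
      ∫⁻ t in Set.Ioi (0 : ℝ), ∫⁻ y in {z | (t, z) ∈ S}, W y := by
  have hslice : ∀ t : ℝ, MeasurableSet {z | (t, z) ∈ S} := fun t =>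
    hS.preimage measurable_prodMk_left
  have hind : Measurable fun p : EuclideanSpace ℝ (Fin d) × ℝ =>
      {z | (p.2, z) ∈ S}.indicator (fun _ => (1 : ℝ≥0∞)) p.1 :=
    (measurable_const.indicator (hS.preimage measurable_swap) :
      Measurable ((Prod.swap ⁻¹' S).indicator fun _ => (1 : ℝ≥0∞)))
  calc _ = ∫⁻ y, ∫⁻ t in Set.Ioi (0 : ℝ),
          W y * {z | (t, z) ∈ S}.indicator (fun _ => (1 : ℝ≥0∞)) y := by
        refine lintegral_congr fun y => ?_
        rw [lintegral_const_mul]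
        exact hind.comp measurable_prodMk_left
    _ = ∫⁻ t in Set.Ioi (0 : ℝ), ∫⁻ y,
          W y * {z | (t, z) ∈ S}.indicator (fun _ => (1 : ℝ≥0∞)) y := by
        refine lintegral_lintegral_swap ?_
        exact ((hW.comp measurable_fst).mul hind).aemeasurable
    _ = _ := by
        refine lintegral_congr fun t => ?_
        rw [← lintegral_indicator (hslice t)]
        refine lintegral_congr fun y => ?_
        by_cases hy : (t, y) ∈ S <;> simp [hy]

lemma measurable_symmRadius_superlevel (f : EuclideanSpace ℝ (Fin d) → ℝ) :
    Measurable fun t : ℝ => symmRadius {y | t < f y} := by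
  have h : Antitone fun t : ℝ => volume {y | t < f y} := fun s t hst =>
    measure_mono fun y (hy : t < f y) => lt_of_le_of_lt hst hy
  unfold symmRadius
  exact ((h.measurable.div_const _).ennreal_toReal).pow_const _

lemma lintegral_mul_symmRearrange (f : EuclideanSpace ℝ (Fin d) → ℝ)
    {W : EuclideanSpace ℝ (Fin d) → ℝ≥0∞} (hW : Measurable W) :
    ∫⁻ y, W y * symmRearrange f y =
      ∫⁻ t in Set.Ioi (0 : ℝ), ∫⁻ y in ballStar {z | t < f z}, W y := by
  have hS : MeasurableSet {p : ℝ × EuclideanSpace ℝ (Fin d) |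
      ‖p.2‖ < symmRadius {y | p.1 < f y}} :=
    measurableSet_lt measurable_snd.norm
      ((measurable_symmRadius_superlevel f).comp measurable_fst)
  have hslice : ∀ t : ℝ, {z | (t, z) ∈ {p : ℝ × EuclideanSpace ℝ (Fin d) |
      ‖p.2‖ < symmRadius {y | p.1 < f y}}} = ballStar {z | t < f z} := by
    intro t
    ext z
    simp [ballStar]
  simpa only [hslice, symmRearrange] using lintegral_mul_lintegral_indicator_slice hS hW

lemma lintegral_mul_ofReal_eq_lintegral_superlevel {f : EuclideanSpace ℝ (Fin d) → ℝ}
    (hf : Measurable f) {W : EuclideanSpace ℝ (Fin d) → ℝ≥0∞} (hW : Measurable W) :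
    ∫⁻ y, W y * ENNReal.ofReal (f y) =
      ∫⁻ t in Set.Ioi (0 : ℝ), ∫⁻ y in {z | t < f z}, W y := by
  have hS : MeasurableSet {p : ℝ × EuclideanSpace ℝ (Fin d) | p.1 < f p.2} :=
    measurableSet_lt measurable_fst (hf.comp measurable_snd)
  have h := lintegral_mul_lintegral_indicator_slice hS hW
  have hlayer : ∀ y, ∫⁻ t in Set.Ioi (0 : ℝ), {z | t < f z}.indicator
      (fun _ => (1 : ℝ≥0∞)) y = ENNReal.ofReal (f y) := by
    intro y
    have : ∀ t : ℝ, {z | t < f z}.indicator (fun _ => (1 : ℝ≥0∞)) y =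
        (Set.Iio (f y)).indicator (fun _ => (1 : ℝ≥0∞)) t := by
      intro t
      simp [Set.indicator]
    simp_rw [this]
    rw [lintegral_indicator measurableSet_Iio, lintegral_one,
      Measure.restrict_restrict measurableSet_Iio, Measure.restrict_apply_univ,
      Set.Iio_inter_Ioi, Real.volume_Ioo, sub_zero]
  simpa only [Set.mem_ofPred_eq, hlayer] using h

lemma symmRadius_nonneg (A : Set (EuclideanSpace ℝ (Fin d))) : 0 ≤ symmRadius A :=
  Real.rpow_nonneg ENNReal.toReal_nonneg _

lemma volume_ball_one_pos : 0 < volume (Metric.ball (0 : EuclideanSpace ℝ (Fin d)) 1) :=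
  Metric.measure_ball_pos _ _ one_pos

lemma volume_ballStar (hd : 1 ≤ d) {A : Set (EuclideanSpace ℝ (Fin d))}
    (hA : volume A ≠ ⊤) : volume (ballStar A) = volume A := by
  have : NeZero d := ⟨by lia⟩
  have hv : volume (Metric.ball (0 : EuclideanSpace ℝ (Fin d)) 1) ≠ ⊤ := measure_ball_lt_top.ne
  have hv0 := (volume_ball_one_pos (d := d)).ne'
  have hq : volume A / volume (Metric.ball (0 : EuclideanSpace ℝ (Fin d)) 1) ≠ ⊤ :=
    ENNReal.div_ne_top hA hv0
  rw [ballStar, Measure.addHaar_ball _ _ (symmRadius_nonneg A), finrank_euclideanSpace_fin,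
    symmRadius, one_div, Real.rpow_inv_natCast_pow ENNReal.toReal_nonneg (by lia),
    ENNReal.ofReal_toReal hq, ENNReal.div_mul_cancel hv0 hv]

lemma symmRadius_mono {A B : Set (EuclideanSpace ℝ (Fin d))} (h : A ⊆ B)
    (hB : volume B ≠ ⊤) : symmRadius A ≤ symmRadius B := by
  unfold symmRadius
  have hq : volume B / volume (Metric.ball (0 : EuclideanSpace ℝ (Fin d)) 1) ≠ ⊤ :=
    ENNReal.div_ne_top hB volume_ball_one_pos.ne'
  gcongr

lemma ballStar_mono {A B : Set (EuclideanSpace ℝ (Fin d))} (h : A ⊆ B)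
    (hB : volume B ≠ ⊤) : ballStar A ⊆ ballStar B :=
  Metric.ball_subset_ball (symmRadius_mono h hB)

lemma tendsto_symmRadius (hd : 1 ≤ d) {A : ℕ → Set (EuclideanSpace ℝ (Fin d))}
    {B : Set (EuclideanSpace ℝ (Fin d))} (hB : volume B ≠ ⊤)
    (h : Tendsto (fun n => volume (A n)) atTop (𝓝 (volume B))) :
    Tendsto (fun n => symmRadius (A n)) atTop (𝓝 (symmRadius B)) := by
  have hd' : (0 : ℝ) ≤ 1 / d := by positivity
  have hv0 := (volume_ball_one_pos (d := d)).ne'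
  unfold symmRadius
  refine Tendsto.rpow_const ?_ (Or.inr hd')
  exact (ENNReal.tendsto_toReal (ENNReal.div_ne_top hB hv0)).comp
    (ENNReal.Tendsto.div_const h (Or.inr hv0))

lemma setLIntegral_le_of_measure_eq {α : Type*} [MeasurableSpace α] {μ : Measure α}
    {A B : Set α} (hA : MeasurableSet A) (hB : MeasurableSet B) (hAB : μ B = μ A)
    (hfin : μ A ≠ ⊤) {W : α → ℝ≥0∞} {c : ℝ≥0∞} (hin : ∀ y ∈ B, W y ≤ c)
    (hout : ∀ y ∉ B, c ≤ W y) : ∫⁻ y in B, W y ∂μ ≤ ∫⁻ y in A, W y ∂μ := by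
  have hdiff : μ (B \ A) = μ (A \ B) := by
    have h1 := measure_inter_add_sdiff (μ := μ) B hA
    have h2 := measure_inter_add_sdiff (μ := μ) A hB
    rw [Set.inter_comm] at h1
    have hne : μ (A ∩ B) ≠ ⊤ := measure_ne_top_of_subset Set.inter_subset_left hfin
    rw [← hAB, ← h1] at h2
    exact ((ENNReal.add_right_inj hne).1 h2).symm
  rw [← lintegral_inter_add_sdiff W B hA, ← lintegral_inter_add_sdiff W A hB, Set.inter_comm]
  refine add_le_add le_rfl ?_
  calc ∫⁻ y in B \ A, W y ∂μ ≤ ∫⁻ _ in B \ A, c ∂μ :=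
        setLIntegral_mono' (hB.diff hA) fun y hy => hin y hy.1
    _ = ∫⁻ _ in A \ B, c ∂μ := by simp [hdiff]
    _ ≤ ∫⁻ y in A \ B, W y ∂μ :=
        setLIntegral_mono' (hA.diff hB) fun y hy => hout y hy.2

lemma setLIntegral_ballStar_le (hd : 1 ≤ d) {A : Set (EuclideanSpace ℝ (Fin d))}
    (hA : MeasurableSet A) (hfin : volume A ≠ ⊤) {w : ℝ → ℝ≥0∞}
    (hw : MonotoneOn w (Set.Ici 0)) :
    ∫⁻ y in ballStar A, w ‖y‖ ≤ ∫⁻ y in A, w ‖y‖ := by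
  refine setLIntegral_le_of_measure_eq hA Metric.isOpen_ball.measurableSet
    (volume_ballStar hd hfin) hfin (c := w (symmRadius A)) ?_ ?_
  · intro y hy
    exact hw (norm_nonneg y) (symmRadius_nonneg A) (mem_ball_zero_iff.1 hy).le
  · intro y hy
    exact hw (symmRadius_nonneg A) (norm_nonneg y)
      (not_lt.1 fun h => hy (mem_ball_zero_iff.2 h))

lemma lintegral_mul_symmRearrange_le (hd : 1 ≤ d) {f : EuclideanSpace ℝ (Fin d) → ℝ}
    (hf : Measurable f) (hfin : VanishesAtInfinity f) {w : ℝ → ℝ≥0∞} (hw_meas : Measurable w)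
    (hw : MonotoneOn w (Set.Ici 0)) :
    ∫⁻ y, w ‖y‖ * symmRearrange f y ≤ ∫⁻ y, w ‖y‖ * ENNReal.ofReal (f y) := by
  have hW : Measurable fun y : EuclideanSpace ℝ (Fin d) => w ‖y‖ := hw_meas.comp measurable_norm
  rw [lintegral_mul_symmRearrange f hW, lintegral_mul_ofReal_eq_lintegral_superlevel hf hW]
  refine setLIntegral_mono' measurableSet_Ioi fun t ht => ?_
  exact setLIntegral_ballStar_le hd (measurableSet_lt measurable_const hf) (hfin t ht).ne hw

lemma symmRearrange_mono {f g : EuclideanSpace ℝ (Fin d) → ℝ} (h : ∀ y, f y ≤ g y)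
    (hg : VanishesAtInfinity g) (x : EuclideanSpace ℝ (Fin d)) :
    symmRearrange f x ≤ symmRearrange g x := by
  refine setLIntegral_mono' measurableSet_Ioi fun t ht => ?_
  exact Set.indicator_le_indicator_of_subset
    (ballStar_mono (fun y (hy : t < f y) => hy.trans_le (h y)) (hg t ht).ne)
    (fun _ => zero_le) x

lemma tendsto_setLIntegral_ballStar (hd : 1 ≤ d) {A : ℕ → Set (EuclideanSpace ℝ (Fin d))}
    {B : Set (EuclideanSpace ℝ (Fin d))} (hB : volume B ≠ ⊤) (hmono : Monotone A)
    (hAB : ∀ n, A n ⊆ B) (h : Tendsto (fun n => volume (A n)) atTop (𝓝 (volume B)))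
    (W : EuclideanSpace ℝ (Fin d) → ℝ≥0∞) :
    Tendsto (fun n => ∫⁻ y in ballStar (A n), W y) atTop (𝓝 (∫⁻ y in ballStar B, W y)) := by
  have hUnion : ⋃ n, ballStar (A n) = ballStar B := by
    refine Set.Subset.antisymm (Set.iUnion_subset fun n => ballStar_mono (hAB n) hB) ?_
    intro y hy
    have hlt := (tendsto_symmRadius hd hB h).eventually (lt_mem_nhds (mem_ball_zero_iff.1 hy))
    obtain ⟨n, hn⟩ := hlt.exists
    exact Set.mem_iUnion.2 ⟨n, mem_ball_zero_iff.2 hn⟩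
  have hball : Monotone fun n => ballStar (A n) := fun m n hmn =>
    ballStar_mono (hmono hmn) (measure_ne_top_of_subset (hAB n) hB)
  have hmeas : ∀ C : Set (EuclideanSpace ℝ (Fin d)), MeasurableSet (ballStar C) :=
    fun C => Metric.isOpen_ball.measurableSet
  have key := tendsto_measure_iUnion_atTop (μ := volume.withDensity W) hball
  rw [hUnion] at key
  simpa only [Function.comp_def, withDensity_apply _ (hmeas _)] using key

lemma vanishesAtInfinity_of_levy {φ : EuclideanSpace ℝ (Fin d) → ℝ} (hφ_meas : Measurable φ)
    (hφ_int : ∫⁻ y, ENNReal.ofReal (‖y‖ ^ 2 / (1 + ‖y‖ ^ 2) * φ y) < ⊤) :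
    VanishesAtInfinity φ := by
  intro t ht
  have hsub : {x | t < φ x} ⊆ Metric.ball 0 1 ∪
      {y | ENNReal.ofReal (t / 2) ≤ ENNReal.ofReal (‖y‖ ^ 2 / (1 + ‖y‖ ^ 2) * φ y)} := by
    intro y (hy : t < φ y)
    rcases lt_or_ge ‖y‖ 1 with h | h
    · exact Or.inl (mem_ball_zero_iff.2 h)
    · refine Or.inr (ENNReal.ofReal_le_ofReal ?_)
      have : 1 / 2 ≤ ‖y‖ ^ 2 / (1 + ‖y‖ ^ 2) := by
        rw [div_le_div_iff₀ (by norm_num) (by positivity)]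
        nlinarith
      nlinarith
  refine (measure_mono hsub).trans_lt ((measure_union_le _ _).trans_lt ?_)
  refine ENNReal.add_lt_top.2 ⟨measure_ball_lt_top, ?_⟩
  have hpos : ENNReal.ofReal (t / 2) ≠ 0 := by simpa using ht
  exact (meas_ge_le_lintegral_div (by fun_prop) hpos ENNReal.ofReal_ne_top).trans_lt
    (ENNReal.div_lt_top hφ_int.ne hpos)

lemma one_sub_cos_inner_le (ξ y : EuclideanSpace ℝ (Fin d)) :
    1 - Real.cos ⟪ξ, y⟫ ≤ (4 + ‖ξ‖ ^ 2) * (‖y‖ ^ 2 / (1 + ‖y‖ ^ 2)) := by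
  have h1 := Real.neg_one_le_cos ⟪ξ, y⟫
  have h2 := Real.one_sub_sq_div_two_le_cos (x := ⟪ξ, y⟫)
  have h3 : ⟪ξ, y⟫ ^ 2 ≤ ‖ξ‖ ^ 2 * ‖y‖ ^ 2 := by
    rw [← mul_pow]
    exact sq_le_sq.2 ((abs_real_inner_le_norm ξ y).trans (le_abs_self _))
  rw [mul_div_assoc', le_div_iff₀ (by positivity)]
  have hs := sq_nonneg ‖y‖
  have hx := sq_nonneg ‖ξ‖
  generalize ‖y‖ ^ 2 = s at *
  generalize ‖ξ‖ ^ 2 = x at *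
  rcases le_total s 1 with h | h
  · nlinarith [mul_nonneg hx hs, mul_nonneg (mul_nonneg hx hs) (sub_nonneg.2 h)]
  · nlinarith [mul_nonneg hx hs]

lemma symmExponentIntegral_lt_top (hd : 1 ≤ d) {φ : EuclideanSpace ℝ (Fin d) → ℝ}
    (hφ_meas : Measurable φ)
    (hφ_int : ∫⁻ y, ENNReal.ofReal (‖y‖ ^ 2 / (1 + ‖y‖ ^ 2) * φ y) < ⊤)
    (ξ : EuclideanSpace ℝ (Fin d)) : symmExponentIntegral φ ξ < ⊤ := by
  let w : ℝ → ℝ≥0∞ := fun r => ENNReal.ofReal (r ^ 2 / (1 + r ^ 2))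
  have hw_meas : Measurable w := by fun_prop
  have hw : MonotoneOn w (Set.Ici 0) := by
    intro a (ha : 0 ≤ a) b (hb : 0 ≤ b) hab
    refine ENNReal.ofReal_le_ofReal ?_
    rw [div_le_div_iff₀ (by positivity) (by positivity)]
    nlinarith
  have hle := lintegral_mul_symmRearrange_le hd hφ_meas
    (vanishesAtInfinity_of_levy hφ_meas hφ_int) hw_meas hw
  have heq : ∫⁻ y, w ‖y‖ * ENNReal.ofReal (φ y) < ⊤ := by
    refine lt_of_eq_of_lt (lintegral_congr fun y => ?_) hφ_int
    rw [ENNReal.ofReal_mul (by positivity)]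
  calc symmExponentIntegral φ ξ
      ≤ ∫⁻ y, ENNReal.ofReal (4 + ‖ξ‖ ^ 2) * (w ‖y‖ * symmRearrange φ y) := by
        refine lintegral_mono fun y => ?_
        rw [← mul_assoc, ← ENNReal.ofReal_mul (by positivity)]
        gcongr
        exact one_sub_cos_inner_le ξ y
    _ = ENNReal.ofReal (4 + ‖ξ‖ ^ 2) * ∫⁻ y, w ‖y‖ * symmRearrange φ y :=
        lintegral_const_mul' _ _ ENNReal.ofReal_ne_top
    _ < ⊤ := ENNReal.mul_lt_top ENNReal.ofReal_lt_top (hle.trans_lt heq)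

lemma phiTrunc_le {φ : EuclideanSpace ℝ (Fin d) → ℝ} (hφ_nonneg : ∀ y, 0 ≤ φ y) (n : ℕ)
    (y : EuclideanSpace ℝ (Fin d)) : phiTrunc φ n y ≤ φ y := by
  unfold phiTrunc
  split_ifs
  exacts [le_rfl, hφ_nonneg y]

lemma superlevel_phiTrunc (φ : EuclideanSpace ℝ (Fin d) → ℝ) (n : ℕ) {t : ℝ} (ht : 0 < t) :
    {y | t < phiTrunc φ n y} = {y | t < φ y} ∩ {y | 1 / (n : ℝ) < ‖y‖} := by
  ext y
  simp only [phiTrunc, Set.mem_ofPred_eq, Set.mem_inter_iff]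
  split_ifs with h
  · exact ⟨fun hy => ⟨hy, h⟩, And.left⟩
  · exact ⟨fun hy => absurd hy ht.not_gt, fun hy => absurd hy.2 h⟩

lemma monotone_superlevel_phiTrunc_succ (φ : EuclideanSpace ℝ (Fin d) → ℝ) {t : ℝ}
    (ht : 0 < t) : Monotone fun n : ℕ => {y | t < phiTrunc φ (n + 1) y} := by
  intro m n hmn
  simp only [superlevel_phiTrunc φ _ ht]
  refine Set.inter_subset_inter_right _ ?_
  intro y (hy : 1 / ((m + 1 : ℕ) : ℝ) < ‖y‖)
  refine lt_of_le_of_lt (b := 1 / ((m + 1 : ℕ) : ℝ)) ?_ hy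
  push_cast
  exact Nat.one_div_le_one_div hmn

lemma tendsto_volume_superlevel_phiTrunc_succ (hd : 1 ≤ d)
    (φ : EuclideanSpace ℝ (Fin d) → ℝ) {t : ℝ} (ht : 0 < t) :
    Tendsto (fun n : ℕ => volume {y | t < phiTrunc φ (n + 1) y}) atTop
      (𝓝 (volume {y | t < φ y})) := by
  have : NeZero d := ⟨by lia⟩
  have hUnion : ⋃ n : ℕ, {y | t < phiTrunc φ (n + 1) y} = {y | t < φ y} \ {0} := by
    ext y
    simp only [superlevel_phiTrunc φ _ ht, Set.mem_iUnion, Set.mem_inter_iff, Set.mem_ofPred_eq,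
      Set.mem_sdiff, Set.mem_singleton_iff, exists_and_left]
    refine and_congr_right fun _ => ⟨?_, fun hy => ?_⟩
    · rintro ⟨n, hn⟩ rfl
      rw [norm_zero] at hn
      exact absurd hn (not_lt.2 (by positivity))
    · obtain ⟨n, hn⟩ := exists_nat_one_div_lt (norm_pos_iff.2 hy)
      exact ⟨n, by push_cast; exact hn⟩
  have key := tendsto_measure_iUnion_atTop (μ := volume)
    (monotone_superlevel_phiTrunc_succ φ ht)
  rw [hUnion, measure_sdiff_null (measure_singleton _)] at key
  exact key

lemma tendsto_symmExponentIntegral_phiTrunc (hd : 1 ≤ d) {φ : EuclideanSpace ℝ (Fin d) → ℝ}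
    (hφ_nonneg : ∀ y, 0 ≤ φ y) (hφ : VanishesAtInfinity φ) (ξ : EuclideanSpace ℝ (Fin d)) :
    Tendsto (fun n => symmExponentIntegral (phiTrunc φ n) ξ) atTop
      (𝓝 (symmExponentIntegral φ ξ)) := by
  rw [← tendsto_add_atTop_iff_nat 1]
  have hW : Measurable fun y : EuclideanSpace ℝ (Fin d) =>
      ENNReal.ofReal (1 - Real.cos ⟪ξ, y⟫) := by fun_prop
  have hsub : ∀ (n : ℕ) (t : ℝ), {y | t < phiTrunc φ n y} ⊆ {y | t < φ y} :=
    fun n t y hy => lt_of_lt_of_le hy (phiTrunc_le hφ_nonneg n y)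
  have hfin : ∀ (n : ℕ) (t : ℝ), 0 < t → volume {y | t < phiTrunc φ n y} ≠ ⊤ :=
    fun n t ht => measure_ne_top_of_subset (hsub n t) (hφ t ht).ne
  simp only [symmExponentIntegral, lintegral_mul_symmRearrange _ hW]
  refine lintegral_tendsto_of_tendsto_of_monotone (fun n => ?_) ?_ ?_
  · refine aemeasurable_restrict_of_antitoneOn measurableSet_Ioi ?_
    intro s hs t _ hst
    refine lintegral_mono_set (ballStar_mono ?_ (hfin (n + 1) s hs))
    exact fun y (hy : t < _) => lt_of_le_of_lt hst hy
  · filter_upwards [ae_restrict_mem measurableSet_Ioi] with t ht m n hmn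
    exact lintegral_mono_set
      (ballStar_mono (monotone_superlevel_phiTrunc_succ φ ht hmn) (hfin (n + 1) t ht))
  · filter_upwards [ae_restrict_mem measurableSet_Ioi] with t ht
    exact tendsto_setLIntegral_ballStar hd (hφ t ht).ne (monotone_superlevel_phiTrunc_succ φ ht)
      (fun n => hsub (n + 1) t) (tendsto_volume_superlevel_phiTrunc_succ hd φ ht) _

end SymmetricRearrangement

/-- **Convergence of symmetrized truncated Lévy–Khintchine exponents.** -/
theorem symm_levy_exponent_tendsto {d : ℕ} (hd : 1 ≤ d)
    (A : Matrix (Fin d) (Fin d) ℝ) (hA : A.PosSemidef)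
    (φ : EuclideanSpace ℝ (Fin d) → ℝ) (hφ_meas : Measurable φ)
    (hφ_nonneg : ∀ y, 0 ≤ φ y)
    (hφ_int : ∫⁻ y, ENNReal.ofReal (‖y‖ ^ 2 / (1 + ‖y‖ ^ 2) * φ y) < ⊤)
    (ε : ℕ → ℝ) (hε_pos : ∀ n, 0 < ε n)
    (hε_lim : Filter.Tendsto ε Filter.atTop (nhds 0))
    (ξ : EuclideanSpace ℝ (Fin d)) :
    (∀ n, symmExponentIntegral (phiTrunc φ n) ξ ≠ ⊤) ∧
      symmExponentIntegral φ ξ ≠ ⊤ ∧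
      Filter.Tendsto
        (fun n => symmExponent (A + ε n • (1 : Matrix (Fin d) (Fin d) ℝ)) (phiTrunc φ n) ξ)
        Filter.atTop (nhds (symmExponent A φ ξ)) := by
  have hφ := vanishesAtInfinity_of_levy hφ_meas hφ_int
  have hfin := symmExponentIntegral_lt_top hd hφ_meas hφ_int ξ
  refine ⟨fun n => ne_top_of_le_ne_top hfin.ne ?_, hfin.ne, ?_⟩
  · refine lintegral_mono fun y => ?_
    gcongr
    exact symmRearrange_mono (phiTrunc_le hφ_nonneg n) hφ y
  · have hM : Tendsto (fun n => A + ε n • (1 : Matrix (Fin d) (Fin d) ℝ)) atTop (𝓝 A) := by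
      simpa using tendsto_const_nhds.add (hε_lim.smul_const (1 : Matrix (Fin d) (Fin d) ℝ))
    have hdet : Tendsto (fun n => (A + ε n • (1 : Matrix (Fin d) (Fin d) ℝ)).det) atTop
        (𝓝 A.det) := ((continuous_id.matrix_det).tendsto A).comp hM
    have hroot := hdet.rpow_const (p := (1 : ℝ) / d) (Or.inr (by positivity))
    exact (ENNReal.tendsto_ofReal ((hroot.const_mul (1 / 2)).mul_const (‖ξ‖ ^ 2))).add
      (tendsto_symmExponentIntegral_phiTrunc hd hφ_nonneg hφ ξ)
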